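/- arXiv:2307.10754 — 2 statements merged into one kernel-verified Lean document; each statement's English description precedes it below -/
import Mathlib

section
/- Let φ(x) = (1/√(2π)) e^{−x²/2}, Φ(x) = ∫_{−∞}^x φ(y) dy, and let H_k denote the k-th probabilist's Hermite polynomial. For every real r > 1 and all z, y ∈ ℝ, the series below converges and Φ((z + y)/√(r − √r)) − Φ((z − y)/√(r − √r)) = 2 φ(z/√r) · Σ_{k=0}^∞ (1/(2k+1)!) · r^{−(2k+1)/4} · H_{2k}(z/√r) · H_{2k+1}(y/r^{1/4}). -/
open Real Finset

/-- The standard Gaussian density `φ(x) = (1/√(2π)) e^{−x²/2}`. -/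
noncomputable def stdGaussianPDF (x : ℝ) : ℝ := (1 / Real.sqrt (2 * π)) * Real.exp (-x ^ 2 / 2)

/-- The standard Gaussian cumulative distribution function `Φ(x) = ∫_{−∞}^x φ(y) dy`. -/
noncomputable def stdGaussianCDF (x : ℝ) : ℝ := ∫ y in Set.Iic x, stdGaussianPDF y

/-- The `k`-th probabilist's Hermite polynomial, given by its explicit expansion:
`H_k(x) = Σ_{j=0}^{⌊k/2⌋} k! (−1)^j / (2^j j! (k−2j)!) x^{k−2j}` (with `H₀ = 1`). -/
noncomputable def hermiteP (k : ℕ) (x : ℝ) : ℝ :=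
  ∑ j ∈ Finset.range (k / 2 + 1),
    ((k.factorial : ℝ) * (-1 : ℝ) ^ j /
        (2 ^ j * (j.factorial : ℝ) * ((k - 2 * j).factorial : ℝ))) * x ^ (k - 2 * j)

open MeasureTheory

/-- The polynomials with exponential generating function `exp (t * w + ε * t ^ 2 / 2)`;
`ε = -1` gives the Hermite polynomials. -/
noncomputable def hermiteWith (ε : ℝ) (k : ℕ) (x : ℝ) : ℝ :=
  ∑ j ∈ Finset.range (k / 2 + 1),
    ((k.factorial : ℝ) * ε ^ j /
        (2 ^ j * (j.factorial : ℝ) * ((k - 2 * j).factorial : ℝ))) * x ^ (k - 2 * j)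

theorem HasSum.sum_range_half {f : ℕ × ℕ → ℂ} {a : ℂ} (h : HasSum f a) :
    HasSum (fun n => ∑ j ∈ range (n / 2 + 1), f (j, n - 2 * j)) a := by
  let e : (Σ n : ℕ, Fin (n / 2 + 1)) ≃ ℕ × ℕ :=
    { toFun := fun p => (p.2, p.1 - 2 * p.2)
      invFun := fun q => ⟨2 * q.1 + q.2, ⟨q.1, by omega⟩⟩
      left_inv := by
        rintro ⟨n, j, hj⟩
        have hn : 2 * j + (n - 2 * j) = n := by omega
        simp only [Sigma.mk.injEq]
        refine ⟨hn, ?_⟩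
        congr 1 <;> simp [hn]
      right_inv := by
        rintro ⟨j, m⟩
        simp }
  have h' := ((e.hasSum_iff (f := f)).mpr h).sigma (fun n => hasSum_fintype _)
  convert h' using 2 with n
  exact (Fin.sum_univ_eq_sum_range (fun j => f (j, n - 2 * j)) (n / 2 + 1)).symm

theorem hasSum_pow_div_factorial_mul (a b : ℂ) :
    HasSum (fun p : ℕ × ℕ => a ^ p.1 / p.1.factorial * (b ^ p.2 / p.2.factorial))
      (Complex.exp (a + b)) := by
  let f (c : ℂ) (n : ℕ) : ℂ := c ^ n / n.factorial
  have h (c : ℂ) : HasSum (f c) (Complex.exp c) := by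
    rw [Complex.exp_eq_exp_ℂ]
    exact NormedSpace.expSeries_div_hasSum_exp c
  have hs (c : ℂ) : Summable fun n : ℕ => ‖f c n‖ := by
    simpa [f] using Real.summable_pow_div_factorial ‖c‖
  change HasSum (fun p : ℕ × ℕ => f a p.1 * f b p.2) _
  clear_value f
  rw [Complex.exp_add]
  exact (h a).mul (h b) (summable_mul_of_summable_norm (hs a) (hs b))

theorem pow_div_factorial_mul_hermiteWith (ε w : ℝ) (t : ℂ) (n : ℕ) :
    t ^ n / n.factorial * (hermiteWith ε n w : ℂ) =
      ∑ j ∈ range (n / 2 + 1), ((ε : ℂ) * t ^ 2 / 2) ^ j / j.factorial *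
        ((t * w) ^ (n - 2 * j) / (n - 2 * j).factorial) := by
  rw [hermiteWith, Complex.ofReal_sum, mul_sum]
  refine sum_congr rfl fun j hj => ?_
  have hj : 2 * j ≤ n := by have := mem_range.mp hj; omega
  have hn : (n.factorial : ℂ) ≠ 0 := by exact_mod_cast n.factorial_ne_zero
  have ht : t ^ n = (t ^ 2) ^ j * t ^ (n - 2 * j) := by
    rw [← pow_mul, ← pow_add, Nat.add_sub_cancel' hj]
  rw [ht, mul_pow, div_pow, mul_pow]
  generalize n - 2 * j = m
  push_cast
  field_simp

theorem hasSum_hermiteWith (ε w : ℝ) (t : ℂ) :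
    HasSum (fun n : ℕ => t ^ n / n.factorial * (hermiteWith ε n w : ℂ))
      (Complex.exp (t * w + ε * t ^ 2 / 2)) := by
  simp only [pow_div_factorial_mul_hermiteWith]
  rw [add_comm]
  exact (hasSum_pow_div_factorial_mul (ε * t ^ 2 / 2) (t * w)).sum_range_half

theorem hasSum_hermiteWith_real (ε w t : ℝ) :
    HasSum (fun n : ℕ => t ^ n / n.factorial * hermiteWith ε n w)
      (Real.exp (t * w + ε * t ^ 2 / 2)) := by
  have h := hasSum_hermiteWith ε w t
  rw [← Complex.hasSum_ofReal]
  exact_mod_cast h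

theorem abs_hermiteP_le {w W : ℝ} (h : |w| ≤ W) (n : ℕ) : |hermiteP n w| ≤ hermiteWith 1 n W := by
  refine (abs_sum_le_sum_abs _ _).trans (sum_le_sum fun j _ => ?_)
  simp only [abs_mul, abs_div, abs_pow, abs_neg, abs_one, Nat.abs_cast, Nat.abs_ofNat]
  gcongr

theorem integral_even_pow_mul_stdGaussianPDF (j : ℕ) :
    ∫ y : ℝ, y ^ (2 * j) * stdGaussianPDF y = (2 * j).factorial / (2 ^ j * j.factorial) := by
  have h1 := integral_comp_abs (f := fun y : ℝ => y ^ (2 * j) * stdGaussianPDF y)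
  have h2 : ∀ y : ℝ, |y| ^ (2 * j) * stdGaussianPDF |y| = y ^ (2 * j) * stdGaussianPDF y := by
    intro y
    simp [stdGaussianPDF, pow_mul]
  have h3 := integral_rpow_mul_exp_neg_mul_rpow (p := 2) (q := 2 * j) (b := 1 / 2) (by norm_num)
    (lt_of_lt_of_le (by norm_num) (by positivity : (0 : ℝ) ≤ 2 * j)) (by norm_num)
  have h4 : ∫ y in Set.Ioi (0 : ℝ), y ^ (2 * j) * stdGaussianPDF y =
      (1 / √(2 * π)) * ∫ y in Set.Ioi (0 : ℝ), y ^ (2 * j : ℝ) *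
        Real.exp (-(1 / 2) * y ^ (2 : ℝ)) := by
    rw [← integral_const_mul]
    refine setIntegral_congr_fun measurableSet_Ioi fun y hy => ?_
    simp only [stdGaussianPDF]
    rw [show (2 * j : ℝ) = ((2 * j : ℕ) : ℝ) by push_cast; ring, Real.rpow_natCast, Real.rpow_two]
    ring_nf
  simp only [h2] at h1
  rw [h1, h4, h3, show ((2 * j : ℝ) + 1) / 2 = j + 1 / 2 by ring, Real.Gamma_nat_add_half]
  rw [show -(2 * (j : ℝ) + 1) / 2 = -(j + 1 / 2) by ring, Real.rpow_neg (by norm_num),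
    Real.rpow_add (by norm_num), Real.rpow_natCast, ← Real.sqrt_eq_rpow,
    Real.sqrt_mul (by norm_num), Real.sqrt_div (by norm_num), Real.sqrt_one, one_div_pow]
  have hf : ((2 * j).factorial : ℝ) = (2 * j - 1).doubleFactorial * (2 ^ j * j.factorial) := by
    rcases j with _ | j
    · simp
    · rw [← Nat.cast_ofNat (R := ℝ), ← Nat.cast_pow, ← Nat.cast_mul, ← Nat.doubleFactorial_two_mul,
        ← Nat.cast_mul, show 2 * (j + 1) = 2 * j + 1 + 1 by ring, Nat.factorial_eq_mul_doubleFactorial]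
      norm_num [mul_comm]
  rw [hf]
  field_simp

theorem integral_odd_pow_mul_stdGaussianPDF (j : ℕ) :
    ∫ y : ℝ, y ^ (2 * j + 1) * stdGaussianPDF y = 0 := by
  have h := integral_neg_eq_self (fun y : ℝ => y ^ (2 * j + 1) * stdGaussianPDF y) volume
  have h2 : ∀ y : ℝ, (-y) ^ (2 * j + 1) * stdGaussianPDF (-y) =
      -(y ^ (2 * j + 1) * stdGaussianPDF y) := by
    intro y
    rw [Odd.neg_pow ⟨j, rfl⟩]
    simp [stdGaussianPDF]
  simp only [h2, integral_neg] at h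
  linarith

theorem integrable_pow_mul_stdGaussianPDF (n : ℕ) :
    Integrable fun y : ℝ => y ^ n * stdGaussianPDF y := by
  have h := (integrable_rpow_mul_exp_neg_mul_sq (b := 1 / 2) (by norm_num) (s := n)
    (lt_of_lt_of_le (by norm_num) n.cast_nonneg)).const_mul (1 / √(2 * π))
  refine h.congr (.of_forall fun y => ?_)
  simp only [stdGaussianPDF, Real.rpow_natCast]
  ring_nf

theorem integral_add_I_mul_pow (n : ℕ) (x : ℝ) :
    ∫ y : ℝ, ((x : ℂ) + Complex.I * y) ^ n * (stdGaussianPDF y : ℂ) = hermiteP n x := by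
  have hexp : ∀ y : ℝ, ((x : ℂ) + Complex.I * y) ^ n * (stdGaussianPDF y : ℂ) =
      ∑ i ∈ range (n + 1), (n.choose i * Complex.I ^ i * x ^ (n - i)) *
        ((y ^ i * stdGaussianPDF y : ℝ) : ℂ) := by
    intro y
    rw [add_comm, add_pow, sum_mul]
    refine sum_congr rfl fun i _ => ?_
    push_cast
    ring
  simp only [hexp]
  rw [integral_finsetSum _ fun i _ => ((integrable_pow_mul_stdGaussianPDF i).ofReal).const_mul _]
  simp only [integral_const_mul, integral_complex_ofReal]
  rw [hermiteP, Complex.ofReal_sum]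
  symm
  refine sum_of_injOn (fun j => 2 * j) (fun a _ b _ h => by simpa using h) ?_ ?_ ?_
  · intro j hj
    simp only [coe_range, Set.mem_Iio] at hj ⊢
    omega
  · intro i hi hi'
    rcases Nat.even_or_odd' i with ⟨j, rfl | rfl⟩
    · refine absurd ⟨j, ?_, rfl⟩ hi'
      simp only [coe_range, Set.mem_Iio, mem_range] at hi ⊢
      omega
    · simp [integral_odd_pow_mul_stdGaussianPDF]
  · intro j hj
    have hj : 2 * j ≤ n := by have := mem_range.mp hj; omega
    rw [integral_even_pow_mul_stdGaussianPDF, Nat.cast_choose ℂ hj, pow_mul, Complex.I_sq]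
    have : ((2 * j).factorial : ℂ) ≠ 0 := by exact_mod_cast (2 * j).factorial_ne_zero
    push_cast
    field_simp

theorem stdGaussianPDF_nonneg (x : ℝ) : 0 ≤ stdGaussianPDF x := by
  unfold stdGaussianPDF; positivity

theorem continuous_stdGaussianPDF : Continuous stdGaussianPDF := by
  unfold stdGaussianPDF; fun_prop

theorem hermiteWith_one_nonneg {W : ℝ} (hW : 0 ≤ W) (n : ℕ) : 0 ≤ hermiteWith 1 n W :=
  (abs_nonneg _).trans (abs_hermiteP_le (abs_of_nonneg hW).le n)

theorem integrable_exp_neg_mul_sq_add_abs {b : ℝ} (hb : 0 < b) (c d : ℝ) :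
    Integrable fun y : ℝ => Real.exp (-b * y ^ 2 + c * |y| + d) := by
  refine ((integrable_exp_neg_mul_sq (half_pos hb)).mul_const
    (Real.exp (c ^ 2 / (2 * b) + d))).mono' (by fun_prop) (.of_forall fun y => ?_)
  rw [Real.norm_eq_abs, Real.abs_exp, ← Real.exp_add]
  refine Real.exp_le_exp.mpr ?_
  have h : 0 ≤ (b * |y| - c) ^ 2 / (2 * b) := by positivity
  have h' : (b * |y| - c) ^ 2 / (2 * b) = b / 2 * y ^ 2 - c * |y| + c ^ 2 / (2 * b) := by
    rw [← sq_abs y]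
    field_simp
    ring
  linarith

/-- A nonnegative majorant, summable in `n`, of the integrand representing the `n`-th term of the
Mehler series. -/
noncomputable def mehlerMajorant (ρ x W : ℝ) (n : ℕ) (y : ℝ) : ℝ :=
  (|ρ| * (|x| + |y|)) ^ n / n.factorial * hermiteWith 1 n W * stdGaussianPDF y

theorem mehlerMajorant_nonneg (ρ x : ℝ) {W : ℝ} (hW : 0 ≤ W) (n : ℕ) (y : ℝ) :
    0 ≤ mehlerMajorant ρ x W n y :=
  mul_nonneg (mul_nonneg (by positivity) (hermiteWith_one_nonneg hW n)) (stdGaussianPDF_nonneg y)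

theorem continuous_mehlerMajorant (ρ x W : ℝ) (n : ℕ) : Continuous (mehlerMajorant ρ x W n) := by
  have := continuous_stdGaussianPDF
  unfold mehlerMajorant
  fun_prop

theorem hasSum_mehlerMajorant (ρ x W y : ℝ) :
    HasSum (fun n => mehlerMajorant ρ x W n y)
      (Real.exp (|ρ| * (|x| + |y|) * W + 1 * (|ρ| * (|x| + |y|)) ^ 2 / 2) * stdGaussianPDF y) :=
  (hasSum_hermiteWith_real 1 W (|ρ| * (|x| + |y|))).mul_right _

theorem integrable_tsum_mehlerMajorant {ρ : ℝ} (hρ : |ρ| < 1) (x W : ℝ) :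
    Integrable fun y => ∑' n, mehlerMajorant ρ x W n y := by
  simp only [(hasSum_mehlerMajorant ρ x W _).tsum_eq]
  have hb : 0 < (1 - ρ ^ 2) / 2 := by
    have := (sq_lt_one_iff_abs_lt_one ρ).mpr hρ
    linarith
  refine ((integrable_exp_neg_mul_sq_add_abs hb (|ρ| * W + ρ ^ 2 * |x|)
    (|ρ| * |x| * W + ρ ^ 2 * x ^ 2 / 2)).mul_const (1 / √(2 * π))).congr (.of_forall fun y => ?_)
  simp only [stdGaussianPDF]
  rw [mul_left_comm, ← Real.exp_add, mul_comm]
  congr 2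
  rw [← sq_abs ρ, ← sq_abs x, ← sq_abs y]
  ring

theorem integrable_mehlerMajorant {ρ : ℝ} (hρ : |ρ| < 1) (x : ℝ) {W : ℝ} (hW : 0 ≤ W) (n : ℕ) :
    Integrable (mehlerMajorant ρ x W n) := by
  refine (integrable_tsum_mehlerMajorant hρ x W).mono'
    (continuous_mehlerMajorant ρ x W n).aestronglyMeasurable (.of_forall fun y => ?_)
  rw [Real.norm_of_nonneg (mehlerMajorant_nonneg ρ x hW n y)]
  exact (hasSum_mehlerMajorant ρ x W y).summable.le_tsum n
    fun m _ => mehlerMajorant_nonneg ρ x hW m y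

theorem summable_integral_mehlerMajorant {ρ : ℝ} (hρ : |ρ| < 1) (x : ℝ) {W : ℝ} (hW : 0 ≤ W) :
    Summable fun n => ∫ y, mehlerMajorant ρ x W n y :=
  (hasSum_integral_of_dominated_convergence (mehlerMajorant ρ x W)
    (fun n => (continuous_mehlerMajorant ρ x W n).aestronglyMeasurable)
    (fun n => .of_forall fun y => (Real.norm_of_nonneg (mehlerMajorant_nonneg ρ x hW n y)).le)
    (.of_forall fun y => (hasSum_mehlerMajorant ρ x W y).summable)
    (integrable_tsum_mehlerMajorant hρ x W)
    (.of_forall fun y => hasSum_mehlerMajorant ρ x W y)).summable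

theorem norm_add_I_mul_pow_le (ρ x W y : ℝ) (n : ℕ) {h : ℝ} (hh : |h| ≤ hermiteWith 1 n W) :
    ‖((ρ : ℂ) * (x + Complex.I * y)) ^ n / n.factorial * h * stdGaussianPDF y‖ ≤
      mehlerMajorant ρ x W n y := by
  have hxy : ‖(x : ℂ) + Complex.I * y‖ ≤ |x| + |y| := by
    refine (norm_add_le _ _).trans ?_
    simp
  simp only [norm_mul, norm_div, norm_pow, Complex.norm_real, Complex.norm_natCast,
    Real.norm_eq_abs, abs_of_nonneg (stdGaussianPDF_nonneg y), mehlerMajorant]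
  have := stdGaussianPDF_nonneg y
  gcongr

theorem integral_mul_add_I_mul_pow (ρ x h : ℝ) (n : ℕ) :
    ∫ y : ℝ, ((ρ : ℂ) * (x + Complex.I * y)) ^ n / n.factorial * h * stdGaussianPDF y =
      ((ρ ^ n / n.factorial * h * hermiteP n x : ℝ) : ℂ) := by
  push_cast
  rw [← integral_add_I_mul_pow, ← integral_const_mul]
  congr 1 with y
  rw [mul_pow]
  ring

theorem abs_mehlerTerm_le {ρ : ℝ} (hρ : |ρ| < 1) (x : ℝ) {w W : ℝ} (hw : |w| ≤ W) (n : ℕ) :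
    |ρ ^ n / n.factorial * hermiteP n w * hermiteP n x| ≤ ∫ y, mehlerMajorant ρ x W n y := by
  rw [← Real.norm_eq_abs, ← Complex.norm_real, ← integral_mul_add_I_mul_pow]
  exact norm_integral_le_of_norm_le
    (integrable_mehlerMajorant hρ x ((abs_nonneg w).trans hw) n)
    (.of_forall fun y => norm_add_I_mul_pow_le ρ x W y n (abs_hermiteP_le hw n))

/-- The Mehler kernel of the Hermite polynomials. -/
noncomputable def mehlerKernel (ρ x w : ℝ) : ℝ :=
  1 / √(1 - ρ ^ 2) * Real.exp (ρ * x * w - ρ ^ 2 * x ^ 2 / 2 -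
    (ρ * w - ρ ^ 2 * x) ^ 2 / (2 * (1 - ρ ^ 2)))

theorem integral_cexp_mul_stdGaussianPDF {ρ : ℝ} (hρ : |ρ| < 1) (x w : ℝ) :
    ∫ y : ℝ, Complex.exp ((ρ : ℂ) * (x + Complex.I * y) * w +
      ((-1 : ℝ) : ℂ) * ((ρ : ℂ) * (x + Complex.I * y)) ^ 2 / 2) * stdGaussianPDF y =
      (mehlerKernel ρ x w : ℂ) := by
  have hs : 0 < 1 - ρ ^ 2 := by
    have := (sq_lt_one_iff_abs_lt_one ρ).mpr hρ
    linarith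
  have hs' : (1 - (ρ : ℂ) ^ 2) ≠ 0 := by exact_mod_cast hs.ne'
  have hint := integral_cexp_quadratic (b := ((-((1 - ρ ^ 2) / 2) : ℝ) : ℂ))
    (by rw [Complex.ofReal_re]; linarith) (Complex.I * (ρ * w - ρ ^ 2 * x))
    (ρ * x * w - ρ ^ 2 * x ^ 2 / 2)
  have hfun : ∀ y : ℝ, Complex.exp ((ρ : ℂ) * (x + Complex.I * y) * w +
      ((-1 : ℝ) : ℂ) * ((ρ : ℂ) * (x + Complex.I * y)) ^ 2 / 2) * stdGaussianPDF y =
      ((1 / √(2 * π) : ℝ) : ℂ) * Complex.exp (((-((1 - ρ ^ 2) / 2) : ℝ) : ℂ) * y ^ 2 +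
        Complex.I * (ρ * w - ρ ^ 2 * x) * y + (ρ * x * w - ρ ^ 2 * x ^ 2 / 2)) := by
    intro y
    rw [stdGaussianPDF, Complex.ofReal_mul, mul_left_comm, Complex.ofReal_exp, ← Complex.exp_add]
    congr 2
    push_cast
    ring_nf
    rw [Complex.I_sq]
    ring
  simp only [hfun]
  rw [integral_const_mul, hint]
  have hroot : ((π : ℂ) / -((-((1 - ρ ^ 2) / 2) : ℝ) : ℂ)) ^ (1 / 2 : ℂ) =
      ((√(2 * π / (1 - ρ ^ 2)) : ℝ) : ℂ) := by
    rw [Real.sqrt_eq_rpow, Complex.ofReal_cpow (by positivity)]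
    congr 1
    · push_cast
      field_simp
    · norm_num
  have hexp : ((ρ : ℂ) * x * w - ρ ^ 2 * x ^ 2 / 2) - (Complex.I * (ρ * w - ρ ^ 2 * x)) ^ 2 /
      (4 * ((-((1 - ρ ^ 2) / 2) : ℝ) : ℂ)) = ((ρ * x * w - ρ ^ 2 * x ^ 2 / 2 -
      (ρ * w - ρ ^ 2 * x) ^ 2 / (2 * (1 - ρ ^ 2)) : ℝ) : ℂ) := by
    rw [mul_pow, Complex.I_sq]
    push_cast
    field_simp
    ring
  rw [hroot, hexp, ← Complex.ofReal_exp, ← Complex.ofReal_mul, ← Complex.ofReal_mul,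
    Complex.ofReal_inj, mehlerKernel, ← mul_assoc]
  congr 1
  rw [Real.sqrt_div (by positivity)]
  field_simp

/-- Mehler's formula. -/
theorem hasSum_mehler {ρ : ℝ} (hρ : |ρ| < 1) (x w : ℝ) :
    HasSum (fun n : ℕ => ρ ^ n / n.factorial * hermiteP n w * hermiteP n x)
      (mehlerKernel ρ x w) := by
  rw [← Complex.hasSum_ofReal, ← integral_cexp_mul_stdGaussianPDF hρ]
  simp only [← integral_mul_add_I_mul_pow]
  have hφ := continuous_stdGaussianPDF
  refine hasSum_integral_of_dominated_convergence (mehlerMajorant ρ x |w|)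
    (fun n => Continuous.aestronglyMeasurable (by fun_prop))
    (fun n => .of_forall fun y => norm_add_I_mul_pow_le ρ x |w| y n (abs_hermiteP_le le_rfl n))
    (.of_forall fun y => (hasSum_mehlerMajorant ρ x |w| y).summable)
    (integrable_tsum_mehlerMajorant hρ x |w|) (.of_forall fun y => ?_)
  exact (hasSum_hermiteWith (-1) w (ρ * (x + Complex.I * y))).mul_right _

theorem hasSum_mehler_even {ρ : ℝ} (hρ : |ρ| < 1) (x w : ℝ) :
    HasSum (fun k : ℕ => ρ ^ (2 * k) / (2 * k).factorial * hermiteP (2 * k) w *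
      hermiteP (2 * k) x) ((mehlerKernel ρ x w + mehlerKernel (-ρ) x w) / 2) := by
  have h := ((hasSum_mehler hρ x w).add
    (hasSum_mehler (ρ := -ρ) (by rwa [abs_neg]) x w)).div_const 2
  rw [← Function.Injective.hasSum_iff (g := fun k : ℕ => 2 * k)
    (fun a b hab => by simpa using hab)] at h
  · refine (congrArg (HasSum · _) (funext fun k => ?_)).mpr h
    simp only [Function.comp_apply, (even_two_mul k).neg_pow]
    ring
  · intro n hn
    have hodd : Odd n := by
      rw [← Nat.not_even_iff_odd, even_iff_exists_two_mul]
      rintro ⟨k, rfl⟩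
      exact hn ⟨k, rfl⟩
    simp only [hodd.neg_pow]
    ring

theorem continuous_hermiteP (n : ℕ) : Continuous (hermiteP n) := by
  unfold hermiteP; fun_prop

theorem hasDerivAt_hermiteP_odd (k : ℕ) (w : ℝ) :
    HasDerivAt (hermiteP (2 * k + 1)) ((2 * k + 1) * hermiteP (2 * k) w) w := by
  unfold hermiteP
  rw [show (2 * k + 1) / 2 = k by omega, show 2 * k / 2 = k by omega, mul_sum]
  refine HasDerivAt.fun_sum fun j hj => ?_
  have hj : j ≤ k := by have := mem_range.mp hj; omega
  obtain ⟨m, rfl⟩ := Nat.exists_eq_add_of_le hj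
  rw [show 2 * (j + m) + 1 - 2 * j = 2 * m + 1 by omega, show 2 * (j + m) - 2 * j = 2 * m by omega]
  refine ((hasDerivAt_pow (2 * m + 1) w).const_mul _).congr_deriv ?_
  rw [Nat.factorial_succ, Nat.factorial_succ]
  push_cast
  field_simp

theorem hermiteP_odd_zero (k : ℕ) : hermiteP (2 * k + 1) 0 = 0 := by
  refine sum_eq_zero fun j hj => ?_
  have := mem_range.mp hj
  rw [zero_pow (by omega), mul_zero]

theorem integral_hermiteP_even (k : ℕ) (w : ℝ) :
    ∫ v in (0 : ℝ)..w, hermiteP (2 * k) v = hermiteP (2 * k + 1) w / (2 * k + 1) := by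
  have h := intervalIntegral.integral_eq_sub_of_hasDerivAt (a := 0) (b := w)
    (fun v _ => hasDerivAt_hermiteP_odd k v)
    ((continuous_hermiteP (2 * k)).const_mul _ |>.intervalIntegrable _ _)
  rw [intervalIntegral.integral_const_mul, hermiteP_odd_zero, sub_zero] at h
  rw [← h]
  field_simp

theorem hasSum_integral_mehler_even {ρ : ℝ} (hρ : |ρ| < 1) (x w : ℝ) :
    HasSum (fun k : ℕ => ρ ^ (2 * k) / (2 * k + 1).factorial * hermiteP (2 * k) x *
      hermiteP (2 * k + 1) w)
      (∫ v in (0 : ℝ)..w, (mehlerKernel ρ x v + mehlerKernel (-ρ) x v) / 2) := by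
  have h := intervalIntegral.hasSum_integral_of_dominated_convergence (μ := volume)
    (a := 0) (b := w)
    (F := fun (k : ℕ) (v : ℝ) => ρ ^ (2 * k) / (2 * k).factorial * hermiteP (2 * k) v *
      hermiteP (2 * k) x)
    (fun k _ => ∫ y, mehlerMajorant ρ x |w| (2 * k) y)
    (fun k => ((continuous_hermiteP (2 * k)).const_mul _ |>.mul_const _).aestronglyMeasurable)
    (fun k => .of_forall fun v hv => abs_mehlerTerm_le hρ x (by
      simpa using Set.abs_sub_left_of_mem_uIcc (Set.uIoc_subset_uIcc hv)) _)
    (.of_forall fun _ _ => (summable_integral_mehlerMajorant hρ x (abs_nonneg w)).comp_injective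
      (fun a b hab => by simpa using hab))
    intervalIntegrable_const
    (.of_forall fun v _ => hasSum_mehler_even hρ x v)
  refine (congrArg (HasSum · _) (funext fun k => ?_)).mpr h
  rw [intervalIntegral.integral_mul_const, intervalIntegral.integral_const_mul,
    integral_hermiteP_even, Nat.factorial_succ]
  push_cast
  field_simp

theorem integrable_stdGaussianPDF : Integrable stdGaussianPDF := by
  simpa using integrable_pow_mul_stdGaussianPDF 0

theorem hasDerivAt_stdGaussianCDF (x : ℝ) :
    HasDerivAt stdGaussianCDF (stdGaussianPDF x) x := by
  have h : stdGaussianCDF = fun u => stdGaussianCDF 0 + ∫ y in (0 : ℝ)..u, stdGaussianPDF y := by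
    ext u
    rw [← intervalIntegral.integral_Iic_sub_Iic integrable_stdGaussianPDF.integrableOn
      integrable_stdGaussianPDF.integrableOn]
    simp [stdGaussianCDF]
  rw [h]
  exact (intervalIntegral.integral_hasDerivAt_right
    (continuous_stdGaussianPDF.intervalIntegrable _ _)
    continuous_stdGaussianPDF.stronglyMeasurable.stronglyMeasurableAtFilter
    continuous_stdGaussianPDF.continuousAt).const_add _

theorem stdGaussianPDF_mul_mehlerKernel {ρ : ℝ} (hρ : |ρ| < 1) (x w : ℝ) :
    stdGaussianPDF x * mehlerKernel ρ x w =
      stdGaussianPDF ((x - ρ * w) / √(1 - ρ ^ 2)) / √(1 - ρ ^ 2) := by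
  have hs : 0 < 1 - ρ ^ 2 := by
    have := (sq_lt_one_iff_abs_lt_one ρ).mpr hρ
    linarith
  have hexp : -((x - ρ * w) / √(1 - ρ ^ 2)) ^ 2 / 2 = -x ^ 2 / 2 +
      (ρ * x * w - ρ ^ 2 * x ^ 2 / 2 - (ρ * w - ρ ^ 2 * x) ^ 2 / (2 * (1 - ρ ^ 2))) := by
    rw [div_pow, Real.sq_sqrt hs.le]
    field_simp
    ring
  rw [stdGaussianPDF, stdGaussianPDF, hexp, Real.exp_add, mehlerKernel]
  ring

theorem continuous_mehlerKernel (ρ x : ℝ) : Continuous (mehlerKernel ρ x) := by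
  unfold mehlerKernel; fun_prop

theorem stdGaussianCDF_sub_eq_integral {ρ : ℝ} (hρ : |ρ| < 1) (x w : ℝ) :
    stdGaussianCDF ((x + ρ * w) / √(1 - ρ ^ 2)) - stdGaussianCDF ((x - ρ * w) / √(1 - ρ ^ 2)) =
      2 * stdGaussianPDF x *
        (ρ * ∫ v in (0 : ℝ)..w, (mehlerKernel ρ x v + mehlerKernel (-ρ) x v) / 2) := by
  have hcont := ((continuous_mehlerKernel ρ x).add (continuous_mehlerKernel (-ρ) x)).div_const 2
  have hderiv (v : ℝ) : HasDerivAt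
      (fun v => stdGaussianCDF ((x + ρ * v) / √(1 - ρ ^ 2)) -
        stdGaussianCDF ((x - ρ * v) / √(1 - ρ ^ 2)))
      (2 * stdGaussianPDF x * ρ * ((mehlerKernel ρ x v + mehlerKernel (-ρ) x v) / 2)) v := by
    have hl := ((hasDerivAt_id v).const_mul ρ)
    refine (((hasDerivAt_stdGaussianCDF _).comp v ((hl.const_add x).div_const √(1 - ρ ^ 2))).sub
      ((hasDerivAt_stdGaussianCDF _).comp v
        ((hl.const_sub x).div_const √(1 - ρ ^ 2)))).congr_deriv ?_
    have h1 := stdGaussianPDF_mul_mehlerKernel hρ x v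
    have h2 := stdGaussianPDF_mul_mehlerKernel (ρ := -ρ) (by rwa [abs_neg]) x v
    rw [neg_sq, neg_mul, sub_neg_eq_add] at h2
    simp only [id]
    linear_combination -ρ * h1 - ρ * h2
  have h := intervalIntegral.integral_eq_sub_of_hasDerivAt (a := 0) (b := w)
    (fun v _ => hderiv v) ((hcont.const_mul _).intervalIntegrable _ _)
  rw [intervalIntegral.integral_const_mul] at h
  simp only [mul_zero, add_zero, sub_zero, sub_self] at h
  rw [← h]
  ring

/-- For `r > 1` and `z, y ∈ ℝ`, the series
`Σ_{k=0}^∞ (1/(2k+1)!) r^{−(2k+1)/4} H_{2k}(z/√r) H_{2k+1}(y/r^{1/4})` converges, with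
sum `S` satisfying
`Φ((z+y)/√(r−√r)) − Φ((z−y)/√(r−√r)) = 2 φ(z/√r) S`. -/
theorem gaussianCDF_difference_expansion (r : ℝ) (hr : 1 < r) (z y : ℝ) :
    ∃ S : ℝ,
      HasSum (fun k : ℕ =>
        (1 / ((2 * k + 1).factorial : ℝ)) * r ^ (-(2 * (k : ℝ) + 1) / 4) *
          hermiteP (2 * k) (z / Real.sqrt r) *
          hermiteP (2 * k + 1) (y / r ^ ((1 : ℝ) / 4))) S ∧
      stdGaussianCDF ((z + y) / Real.sqrt (r - Real.sqrt r)) -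
          stdGaussianCDF ((z - y) / Real.sqrt (r - Real.sqrt r)) =
        2 * stdGaussianPDF (z / Real.sqrt r) * S := by
  have hr0 : 0 < r := zero_lt_one.trans hr
  set ρ : ℝ := r ^ (-(1 : ℝ) / 4) with hρdef
  have hρ0 : 0 < ρ := Real.rpow_pos_of_pos hr0 _
  have hρ1 : ρ < 1 := Real.rpow_lt_one_of_one_lt_of_neg hr (by norm_num)
  have hρ : |ρ| < 1 := by rwa [abs_of_pos hρ0]
  have hinv : r ^ ((1 : ℝ) / 4) = ρ⁻¹ := by
    rw [hρdef, ← Real.rpow_neg hr0.le]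
    norm_num
  have hsqrt : √r = (ρ ^ 2)⁻¹ := by
    rw [← inv_pow, ← hinv, Real.sqrt_eq_rpow, ← Real.rpow_mul_natCast hr0.le]
    norm_num
  have hr4 : r = (ρ ^ 4)⁻¹ := by
    rw [← Real.sq_sqrt hr0.le, hsqrt]
    ring
  have hσ : √(r - √r) = √(1 - ρ ^ 2) * (ρ ^ 2)⁻¹ := by
    rw [hsqrt]
    nth_rewrite 1 [hr4]
    rw [← Real.sqrt_sq (inv_nonneg.mpr (sq_nonneg ρ)), ← Real.sqrt_mul' _ (sq_nonneg _),
      Real.sqrt_sq (by positivity)]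
    congr 1
    field_simp
  have hpow (k : ℕ) : r ^ (-(2 * (k : ℝ) + 1) / 4) = ρ * ρ ^ (2 * k) := by
    rw [← pow_succ', hρdef, ← Real.rpow_mul_natCast hr0.le]
    congr 1
    push_cast
    ring
  refine ⟨_, (congrArg (HasSum · _) (funext fun k => ?_)).mpr
    ((hasSum_integral_mehler_even hρ (z / √r) (y / r ^ ((1 : ℝ) / 4))).mul_left ρ), ?_⟩
  · rw [hpow]
    ring
  · rw [← stdGaussianCDF_sub_eq_integral hρ, hσ, hsqrt, hinv]
    congr 2 <;> field_simp
end

section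
/- Let φ(x) = (1/√(2π)) e^{−x²/2}, H_k the k-th probabilist's Hermite polynomial, and for κ > 1 set r_n = n^{1/κ}. Fix m ∈ ℕ, K > 0, and an integer J with J > 2m + (Kκ + 1)/2. For n ≥ 2 and y, z ∈ ℝ define ε_n(y,z) = (√r_n/√(r_n − √r_n)) · [φ((z − y)/√(r_n − √r_n)) − φ((z + y)/√(r_n − √r_n))] − 2 φ(z/√r_n) · Σ_{k=0}^J (1/(2k+1)!) · r_n^{−(2k+1)/4} · H_{2k+1}(z/√r_n) · H_{2k+1}(y/r_n^{1/4}). Then r_n^{m+1} · sup{ |ε_n(y,z)| : z ∈ ℝ, |y| ≤ √(K √r_n · log n) } → 0 as n → ∞. -/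
open Real Finset Filter

/-- The sequence `r_n = n^{1/κ}`. -/
noncomputable def rseq (κ : ℝ) (n : ℕ) : ℝ := (n : ℝ) ^ ((1 : ℝ) / κ)

/-- The error `ε_n(y,z)` in the truncated (at order `J`) expansion of
`(√r_n/√(r_n−√r_n)) [φ((z−y)/√(r_n−√r_n)) − φ((z+y)/√(r_n−√r_n))]`
in Hermite polynomials. -/
noncomputable def pdfExpErr (κ : ℝ) (J : ℕ) (n : ℕ) (y z : ℝ) : ℝ :=
  (Real.sqrt (rseq κ n) / Real.sqrt (rseq κ n - Real.sqrt (rseq κ n))) *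
      (stdGaussianPDF ((z - y) / Real.sqrt (rseq κ n - Real.sqrt (rseq κ n))) -
        stdGaussianPDF ((z + y) / Real.sqrt (rseq κ n - Real.sqrt (rseq κ n)))) -
    2 * stdGaussianPDF (z / Real.sqrt (rseq κ n)) *
      ∑ k ∈ Finset.range (J + 1),
        (1 / ((2 * k + 1).factorial : ℝ)) * (rseq κ n) ^ (-(2 * (k : ℝ) + 1) / 4) *
          hermiteP (2 * k + 1) (z / Real.sqrt (rseq κ n)) *
          hermiteP (2 * k + 1) (y / (rseq κ n) ^ ((1 : ℝ) / 4))

/-- The `j`-th term of `H_k(x) / k!`, extended by zero to all `j`. -/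
noncomputable def hermiteTerm (x : ℝ) (k j : ℕ) : ℝ :=
  if 2 * j ≤ k then (-1 : ℝ) ^ j / (2 ^ j * (j.factorial : ℝ) * ((k - 2 * j).factorial : ℝ)) *
    x ^ (k - 2 * j) else 0

lemma hermiteP_eq_sum_hermiteTerm (x : ℝ) {k N : ℕ} (hN : k / 2 < N) :
    hermiteP k x = k.factorial * ∑ j ∈ range N, hermiteTerm x k j := by
  have hsub : range (k / 2 + 1) ⊆ range N := by
    intro j hj; simp only [Finset.mem_range] at *; omega
  rw [hermiteP, ← Finset.sum_subset hsub, Finset.mul_sum]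
  · refine Finset.sum_congr rfl fun j hj => ?_
    rw [hermiteTerm, if_pos (by simp only [Finset.mem_range] at hj; omega)]
    ring
  · intro j _ hj
    rw [hermiteTerm, if_neg (by simp only [Finset.mem_range] at hj; omega)]

lemma hermiteTerm_zero (x : ℝ) (k : ℕ) :
    (k + 2) * hermiteTerm x (k + 2) 0 = x * hermiteTerm x (k + 1) 0 := by
  simp only [hermiteTerm, mul_zero, Nat.zero_le, if_true, Nat.sub_zero, pow_zero,
    Nat.factorial_zero, Nat.factorial_succ]
  push_cast
  field_simp
  ring

lemma hermiteTerm_succ (x : ℝ) (k j : ℕ) :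
    (k + 2) * hermiteTerm x (k + 2) (j + 1) =
      x * hermiteTerm x (k + 1) (j + 1) - hermiteTerm x k j := by
  rcases lt_trichotomy k (2 * j) with h | h | h
  · rw [hermiteTerm, hermiteTerm, hermiteTerm, if_neg (by omega), if_neg (by omega),
      if_neg (by omega)]
    ring
  · rw [hermiteTerm, hermiteTerm, hermiteTerm, if_pos (by omega), if_neg (by omega),
      if_pos (by omega)]
    subst h
    simp only [show 2 * j + 2 - 2 * (j + 1) = 0 by omega, Nat.sub_self, Nat.factorial_succ,
      Nat.factorial_zero]
    push_cast
    field_simp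
    ring
  · obtain ⟨i, rfl⟩ : ∃ i, k = 2 * j + i + 1 := ⟨k - 2 * j - 1, by omega⟩
    rw [hermiteTerm, hermiteTerm, hermiteTerm, if_pos (by omega), if_pos (by omega),
      if_pos (by omega)]
    simp only [show 2 * j + i + 1 + 2 - 2 * (j + 1) = i + 1 by omega,
      show 2 * j + i + 1 + 1 - 2 * (j + 1) = i by omega,
      show 2 * j + i + 1 - 2 * j = i + 1 by omega, Nat.factorial_succ]
    push_cast
    field_simp
    ring

lemma hermiteP_add_two (x : ℝ) (k : ℕ) :
    hermiteP (k + 2) x = x * hermiteP (k + 1) x - (k + 1) * hermiteP k x := by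
  rw [hermiteP_eq_sum_hermiteTerm x (N := k + 3) (by omega),
    hermiteP_eq_sum_hermiteTerm x (k := k + 1) (N := k + 3) (by omega),
    hermiteP_eq_sum_hermiteTerm x (k := k) (N := k + 2) (by omega)]
  have h : (k + 2) * ∑ j ∈ range (k + 3), hermiteTerm x (k + 2) j =
      x * ∑ j ∈ range (k + 3), hermiteTerm x (k + 1) j -
        ∑ j ∈ range (k + 2), hermiteTerm x k j := by
    rw [Finset.sum_range_succ', Finset.sum_range_succ' _ (k + 2), mul_add, mul_add,
      hermiteTerm_zero, Finset.mul_sum, Finset.mul_sum,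
      Finset.sum_congr rfl fun j _ => hermiteTerm_succ x k j, Finset.sum_sub_distrib]
    ring
  simp only [Nat.factorial_succ]
  push_cast
  linear_combination ((k : ℝ) + 1) * k.factorial * h

lemma hermiteP_zero (x : ℝ) : hermiteP 0 x = 1 := by simp [hermiteP]

lemma hermiteP_one (x : ℝ) : hermiteP 1 x = x := by simp [hermiteP]

lemma abs_pow_le_sqrt_factorial_mul_exp (x : ℝ) (p : ℕ) :
    |x| ^ p ≤ √(p.factorial * 2 ^ p) * exp (x ^ 2 / 4) := by
  refine abs_le_of_sq_le_sq' ?_ (by positivity) |>.2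
  rw [mul_pow, Real.sq_sqrt (by positivity), ← Real.exp_nat_mul]
  have h := Real.pow_div_factorial_le_exp (x := x ^ 2 / 2) (by positivity) p
  rw [div_le_iff₀ (by positivity), div_pow, div_le_iff₀ (by positivity)] at h
  calc (|x| ^ p) ^ 2 = (x ^ 2) ^ p := by rw [← pow_mul, mul_comm, pow_mul, sq_abs]
    _ ≤ _ := h
    _ = _ := by push_cast; ring_nf

lemma factorial_le_three_pow_mul (i j : ℕ) :
    (2 * j + i).factorial ≤ 3 ^ (2 * j + i) * (j.factorial * j.factorial * i.factorial) := by
  have h₁ := Nat.add_choose_mul_factorial_mul_factorial (2 * j) i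
  have h₂ := Nat.add_choose_mul_factorial_mul_factorial j j
  have h₃ : 2 ^ (2 * j) * (2 * j + i).choose (2 * j) ≤ 3 ^ (2 * j + i) := by
    have h := Finset.single_le_sum (f := fun m => 2 ^ m * 1 ^ (2 * j + i - m) *
      (2 * j + i).choose m) (fun _ _ => Nat.zero_le _)
      (Finset.mem_range.2 (by omega : 2 * j < 2 * j + i + 1))
    have h' := add_pow 2 1 (2 * j + i)
    norm_num at h h'
    rwa [h']
  rw [← two_mul] at h₂
  calc (2 * j + i).factorial
      = (2 * j + i).choose (2 * j) * (2 * j).choose j *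
        (j.factorial * j.factorial * i.factorial) := by
        rw [← h₁, ← h₂, Nat.choose_symm_add]; ring
    _ ≤ (2 * j + i).choose (2 * j) * 2 ^ (2 * j) *
        (j.factorial * j.factorial * i.factorial) := by
        gcongr; exact Nat.choose_le_two_pow _ _
    _ ≤ _ := by rw [mul_comm ((2 * j + i).choose _)]; gcongr

lemma abs_hermiteTerm_le (x : ℝ) (k j : ℕ) :
    √k.factorial * |hermiteTerm x k j| ≤ √6 ^ k * exp (x ^ 2 / 4) := by
  rw [hermiteTerm]
  split_ifs with h
  swap
  · simp only [abs_zero, mul_zero]; positivity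
  obtain ⟨i, rfl⟩ := Nat.exists_eq_add_of_le h
  rw [Nat.add_sub_cancel_left, abs_mul, abs_div, abs_pow, abs_neg, abs_one, one_pow, abs_pow,
    abs_of_pos (by positivity : (0 : ℝ) < 2 ^ j * j.factorial * i.factorial)]
  have hf : ((2 * j + i).factorial : ℝ) ≤
      3 ^ (2 * j + i) * (j.factorial * j.factorial * i.factorial) := by
    exact_mod_cast factorial_le_three_pow_mul i j
  have key : √(2 * j + i).factorial * (1 / (2 ^ j * j.factorial * i.factorial)) *
      √(i.factorial * 2 ^ i) ≤ √6 ^ (2 * j + i) := by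
    refine abs_le_of_sq_le_sq' ?_ (by positivity) |>.2
    rw [mul_pow, mul_pow, Real.sq_sqrt (by positivity), Real.sq_sqrt (by positivity), ← pow_mul,
      mul_comm _ 2, pow_mul, Real.sq_sqrt (by positivity), div_pow, one_pow, mul_one_div,
      div_mul_eq_mul_div, div_le_iff₀ (by positivity)]
    calc ((2 * j + i).factorial : ℝ) * (i.factorial * 2 ^ i)
        ≤ 3 ^ (2 * j + i) * (j.factorial * j.factorial * i.factorial) *
          (i.factorial * 2 ^ i) := by gcongr
      _ = 3 ^ (2 * j + i) * 2 ^ i * (j.factorial * j.factorial * i.factorial * i.factorial) := by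
        ring
      _ ≤ 3 ^ (2 * j + i) * 2 ^ (2 * j + i) * 2 ^ (2 * j) *
          (j.factorial * j.factorial * i.factorial * i.factorial) := by
        have : (2 : ℝ) ^ i ≤ 2 ^ (2 * j + i) := pow_le_pow_right₀ one_le_two (by omega)
        have : (1 : ℝ) ≤ 2 ^ (2 * j) := one_le_pow₀ one_le_two
        gcongr ?_ * _
        rw [mul_assoc]
        gcongr
        nlinarith [pow_pos (zero_lt_two' ℝ) i]
      _ = 6 ^ (2 * j + i) * (2 ^ j * j.factorial * i.factorial) ^ 2 := by
        rw [show (6 : ℝ) = 3 * 2 by norm_num, mul_pow]; ring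
  calc _ ≤ √(2 * j + i).factorial * (1 / (2 ^ j * j.factorial * i.factorial) *
        (√(i.factorial * 2 ^ i) * exp (x ^ 2 / 4))) := by
        gcongr; exact abs_pow_le_sqrt_factorial_mul_exp x i
    _ = √(2 * j + i).factorial * (1 / (2 ^ j * j.factorial * i.factorial)) *
      √(i.factorial * 2 ^ i) * exp (x ^ 2 / 4) := by ring
    _ ≤ _ := by gcongr

/-- A geometric weakening of Cramér's inequality for the Hermite polynomials. -/
lemma abs_hermiteP_le_s12 (x : ℝ) (k : ℕ) :
    |hermiteP k x| ≤ √k.factorial * √24 ^ k * exp (x ^ 2 / 4) := by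
  rw [hermiteP_eq_sum_hermiteTerm x (N := k + 1) (by omega), abs_mul, Nat.abs_cast]
  calc (k.factorial : ℝ) * |∑ j ∈ range (k + 1), hermiteTerm x k j|
      ≤ k.factorial * ∑ j ∈ range (k + 1), |hermiteTerm x k j| := by
        gcongr; exact Finset.abs_sum_le_sum_abs _ _
    _ = √k.factorial * ∑ j ∈ range (k + 1), √k.factorial * |hermiteTerm x k j| := by
        rw [← Finset.mul_sum, ← mul_assoc, Real.mul_self_sqrt (by positivity)]
    _ ≤ √k.factorial * ∑ j ∈ range (k + 1), √6 ^ k * exp (x ^ 2 / 4) := by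
        gcongr _ * ?_
        exact Finset.sum_le_sum fun j _ => abs_hermiteTerm_le x k j
    _ = √k.factorial * ((k + 1 : ℕ) * √6 ^ k * exp (x ^ 2 / 4)) := by
        rw [Finset.sum_const, Finset.card_range, nsmul_eq_mul]; ring
    _ ≤ √k.factorial * (2 ^ k * √6 ^ k * exp (x ^ 2 / 4)) := by
        have : ((k + 1 : ℕ) : ℝ) ≤ 2 ^ k := by exact_mod_cast Nat.lt_two_pow_self (n := k)
        gcongr
    _ = _ := by
        rw [show (24 : ℝ) = 2 ^ 2 * 6 by norm_num, Real.sqrt_mul (by positivity),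
          Real.sqrt_sq (by positivity), mul_pow]
        ring

/-- The coefficient of `t ^ k` in Mehler's expansion. -/
noncomputable def mehlerCoeff (x w : ℝ) (k : ℕ) : ℝ :=
  hermiteP k x * hermiteP k w / k.factorial

lemma abs_mehlerCoeff_le (x w : ℝ) (k : ℕ) :
    |mehlerCoeff x w k| ≤ 24 ^ k * exp ((x ^ 2 + w ^ 2) / 4) := by
  rw [mehlerCoeff, abs_div, abs_mul, Nat.abs_cast, div_le_iff₀ (by positivity)]
  calc |hermiteP k x| * |hermiteP k w|
      ≤ (√k.factorial * √24 ^ k * exp (x ^ 2 / 4)) *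
        (√k.factorial * √24 ^ k * exp (w ^ 2 / 4)) := by
        gcongr <;> exact abs_hermiteP_le_s12 _ k
    _ = (√k.factorial * √k.factorial) * (√24 * √24) ^ k *
        (exp (x ^ 2 / 4) * exp (w ^ 2 / 4)) := by ring
    _ = _ := by
        rw [Real.mul_self_sqrt (by positivity), Real.mul_self_sqrt (by positivity),
          ← Real.exp_add, ← add_div]
        ring

lemma mehlerCoeff_zero (x w : ℝ) : mehlerCoeff x w 0 = 1 := by
  simp [mehlerCoeff, hermiteP_zero]

lemma mehlerCoeff_one (x w : ℝ) : mehlerCoeff x w 1 = x * w := by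
  simp [mehlerCoeff, hermiteP_one]

lemma mehlerCoeff_two (x w : ℝ) : 2 * mehlerCoeff x w 2 = (x ^ 2 - 1) * (w ^ 2 - 1) := by
  have h := fun u => hermiteP_add_two u 0
  simp only [zero_add, hermiteP_zero, hermiteP_one] at h
  simp only [mehlerCoeff, h, Nat.factorial_two]
  push_cast
  ring

lemma mehlerCoeff_three (x w : ℝ) :
    6 * mehlerCoeff x w 3 = (x ^ 3 - 3 * x) * (w ^ 3 - 3 * w) := by
  have h₂ := fun u => hermiteP_add_two u 0
  have h₃ := fun u => hermiteP_add_two u 1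
  simp only [zero_add, hermiteP_zero, hermiteP_one, Nat.reduceAdd] at h₂ h₃
  simp only [mehlerCoeff, h₂, h₃, show Nat.factorial 3 = 6 from rfl]
  push_cast
  ring

lemma mehlerCoeff_add_four (x w : ℝ) (n : ℕ) :
    (n + 4) * mehlerCoeff x w (n + 4) - 2 * ((n + 2) * mehlerCoeff x w (n + 2)) +
        n * mehlerCoeff x w n =
      x * w * mehlerCoeff x w (n + 3) + (1 - x ^ 2 - w ^ 2) * mehlerCoeff x w (n + 2) +
        x * w * mehlerCoeff x w (n + 1) - mehlerCoeff x w n := by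
  simp only [mehlerCoeff, hermiteP_add_two _ (n + 2), hermiteP_add_two _ (n + 1),
    hermiteP_add_two _ n, Nat.factorial_succ]
  push_cast
  field_simp
  ring

lemma summable_mehlerCoeff_mul_pow (x w : ℝ) {t : ℝ} (ht : |t| < 1 / 48) :
    Summable fun k => mehlerCoeff x w k * t ^ k := by
  refine Summable.of_norm_bounded (g := fun k : ℕ => exp ((x ^ 2 + w ^ 2) / 4) * (1 / 2) ^ k)
    ((summable_geometric_of_lt_one (by norm_num) (by norm_num)).mul_left _) fun k => ?_
  rw [Real.norm_eq_abs, abs_mul, abs_pow]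
  calc |mehlerCoeff x w k| * |t| ^ k
      ≤ 24 ^ k * exp ((x ^ 2 + w ^ 2) / 4) * (1 / 48) ^ k := by
        gcongr; exact abs_mehlerCoeff_le x w k
    _ = exp ((x ^ 2 + w ^ 2) / 4) * (24 * (1 / 48)) ^ k := by rw [mul_pow]; ring
    _ = _ := by norm_num

lemma abs_mehlerCoeff_deriv_le (x w : ℝ) (k : ℕ) {t : ℝ} (ht : |t| < 1 / 48) :
    |k * mehlerCoeff x w k * t ^ (k - 1)| ≤
      48 * exp ((x ^ 2 + w ^ 2) / 4) * ((k : ℝ) ^ 1 * (1 / 2) ^ k) := by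
  rcases k with _ | k
  · simp
  rw [abs_mul, abs_mul, Nat.abs_cast, abs_pow, Nat.add_sub_cancel, pow_one]
  calc ((k + 1 : ℕ) : ℝ) * |mehlerCoeff x w (k + 1)| * |t| ^ k
      ≤ (k + 1 : ℕ) * (24 ^ (k + 1) * exp ((x ^ 2 + w ^ 2) / 4)) * (1 / 48) ^ k := by
        gcongr; exact abs_mehlerCoeff_le x w _
    _ = 48 * exp ((x ^ 2 + w ^ 2) / 4) * ((k + 1 : ℕ) * (24 * (1 / 48)) ^ (k + 1)) := by
        rw [mul_pow]; ring
    _ = _ := by norm_num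

lemma summable_mehlerCoeff_deriv_bound (x w : ℝ) :
    Summable fun k : ℕ => 48 * exp ((x ^ 2 + w ^ 2) / 4) * ((k : ℝ) ^ 1 * (1 / 2) ^ k) := by
  have h : ‖(1 / 2 : ℝ)‖ < 1 := by norm_num
  exact (summable_pow_mul_geometric_of_norm_lt_one 1 h).mul_left _

lemma hasDerivAt_tsum_mehlerCoeff (x w : ℝ) {t : ℝ} (ht : |t| < 1 / 48) :
    HasDerivAt (fun s => ∑' k, mehlerCoeff x w k * s ^ k)
      (∑' k : ℕ, k * mehlerCoeff x w k * t ^ (k - 1)) t := by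
  refine hasDerivAt_tsum_of_isPreconnected (t := Metric.ball (0 : ℝ) (1 / 48)) (y₀ := 0)
    (g := fun k s => mehlerCoeff x w k * s ^ k)
    (g' := fun k s => k * mehlerCoeff x w k * s ^ (k - 1))
    (summable_mehlerCoeff_deriv_bound x w) Metric.isOpen_ball
    (convex_ball _ _).isPreconnected (fun k s _ => ?_) (fun k s hs => ?_)
    (by simp) (summable_mehlerCoeff_mul_pow x w (by simp)) (by simpa using ht)
  · exact ((hasDerivAt_pow k s).const_mul _).congr_deriv (by ring)
  · exact abs_mehlerCoeff_deriv_le x w k (by simpa using hs)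

/-- The differential equation in `t` satisfied by the Mehler series. -/
lemma tsum_mehlerCoeff_ode (x w : ℝ) {t : ℝ} (ht : |t| < 1 / 48) :
    (1 - t ^ 2) ^ 2 * ∑' k : ℕ, k * mehlerCoeff x w k * t ^ (k - 1) =
      (t * (1 - t ^ 2) + x * w * (1 + t ^ 2) - t * (x ^ 2 + w ^ 2)) *
        ∑' k, mehlerCoeff x w k * t ^ k := by
  have hF := (summable_mehlerCoeff_mul_pow x w ht).hasSum
  have hD := (Summable.of_norm_bounded
    (f := fun k : ℕ => k * mehlerCoeff x w k * t ^ (k - 1))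
    (summable_mehlerCoeff_deriv_bound x w) fun k => abs_mehlerCoeff_deriv_le x w k ht).hasSum
  set F := ∑' k, mehlerCoeff x w k * t ^ k
  set D := ∑' k : ℕ, k * mehlerCoeff x w k * t ^ (k - 1)
  have F₁ := (hasSum_nat_add_iff' 1).2 hF
  have F₂ := (hasSum_nat_add_iff' 2).2 hF
  have F₃ := (hasSum_nat_add_iff' 3).2 hF
  have D₂ := (hasSum_nat_add_iff' 2).2 hD
  have D₄ := (hasSum_nat_add_iff' 4).2 hD
  have total := ((D₄.sub (D₂.mul_left (2 * t ^ 2))).add (hD.mul_left (t ^ 4))).sub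
    (((F₃.mul_left (x * w)).add (F₂.mul_left ((1 - x ^ 2 - w ^ 2) * t))).add
      ((F₁.mul_left (x * w * t ^ 2)).sub (hF.mul_left (t ^ 3))))
  have hzero := total.unique (a₂ := 0) (by
    convert hasSum_zero with n
    have h := mehlerCoeff_add_four x w n
    have hn : (n : ℝ) * t ^ (n - 1) * t = n * t ^ n := by
      rcases n with _ | n
      · simp
      · rw [Nat.add_sub_cancel, mul_assoc, ← pow_succ]
    simp only [show n + 4 - 1 = n + 3 by omega, show n + 2 - 1 = n + 1 by omega]
    push_cast
    linear_combination t ^ (n + 3) * h + t ^ 3 * mehlerCoeff x w n * hn)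
  simp only [Finset.sum_range_succ, Finset.sum_range_zero, mehlerCoeff_zero, mehlerCoeff_one]
    at hzero
  norm_num at hzero
  linear_combination hzero + (t - x * w * t ^ 2 / 2) * mehlerCoeff_two x w +
    t ^ 2 / 2 * mehlerCoeff_three x w

/-- Mehler's formula for the Hermite polynomials, for small values of the parameter. -/
lemma tsum_mehlerCoeff (x w : ℝ) {t : ℝ} (ht : |t| < 1 / 48) :
    (∑' k, mehlerCoeff x w k * t ^ k) *
      (√(1 - t ^ 2) * exp ((t ^ 2 * (x ^ 2 + w ^ 2) - 2 * t * (x * w)) / (2 * (1 - t ^ 2)))) =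
        1 := by
  set D : ℝ → ℝ := fun t => (∑' k, mehlerCoeff x w k * t ^ k) *
      (√(1 - t ^ 2) * exp ((t ^ 2 * (x ^ 2 + w ^ 2) - 2 * t * (x * w)) / (2 * (1 - t ^ 2))))
    with hDdef
  have hD : ∀ s ∈ Metric.ball (0 : ℝ) (1 / 48), HasDerivAt D 0 s := by
    intro s hs
    replace hs : |s| < 1 / 48 := by simpa using hs
    have hpos : 0 < 1 - s ^ 2 := by nlinarith [abs_lt.1 hs]
    have hsq : HasDerivAt (fun t : ℝ => 1 - t ^ 2) (-(2 * s)) s := by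
      simpa using (hasDerivAt_pow 2 s).const_sub 1
    have hnum : HasDerivAt (fun t : ℝ => t ^ 2 * (x ^ 2 + w ^ 2) - 2 * t * (x * w))
        (2 * s * (x ^ 2 + w ^ 2) - 2 * (x * w)) s := by
      exact (((hasDerivAt_pow 2 s).mul_const (x ^ 2 + w ^ 2)).sub
        (((hasDerivAt_id s).const_mul 2).mul_const (x * w))).congr_deriv (by simp)
    have hexp := (hnum.div (hsq.const_mul 2) (by positivity)).exp
    refine ((hasDerivAt_tsum_mehlerCoeff x w hs).mul
      ((hsq.sqrt hpos.ne').mul hexp)).congr_deriv ?_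
    have hode := tsum_mehlerCoeff_ode x w hs
    simp only [Pi.div_apply, Pi.mul_apply]
    set G := ∑' k : ℕ, k * mehlerCoeff x w k * s ^ (k - 1)
    set F := ∑' k, mehlerCoeff x w k * s ^ k
    set e := exp ((s ^ 2 * (x ^ 2 + w ^ 2) - 2 * s * (x * w)) / (2 * (1 - s ^ 2)))
    have hr : √(1 - s ^ 2) ≠ 0 := (Real.sqrt_pos.2 hpos).ne'
    have hr2 : √(1 - s ^ 2) ^ 2 = 1 - s ^ 2 := Real.sq_sqrt hpos.le
    set r := √(1 - s ^ 2)
    rw [← hr2] at hode ⊢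
    field_simp
    linear_combination e * hode + F * e * ((x ^ 2 + w ^ 2) * s - x * w) * hr2
  have hconst := Metric.isOpen_ball.is_const_of_deriv_eq_zero (convex_ball _ _).isPreconnected
    (fun s hs => (hD s hs).differentiableAt.differentiableWithinAt) (fun s hs => (hD s hs).deriv)
    (x := t) (y := 0) (by simpa using ht) (by simp)
  have h0 : D 0 = 1 := by
    simp only [hDdef]
    rw [tsum_eq_single 0 (by intro k hk; simp [hk])]
    simp [mehlerCoeff_zero]
  exact hconst.trans h0

lemma stdGaussianPDF_div_eq_tsum (x w : ℝ) {t : ℝ} (ht : |t| < 1 / 48) :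
    1 / √(1 - t ^ 2) * stdGaussianPDF ((x - t * w) / √(1 - t ^ 2)) =
      stdGaussianPDF x * ∑' k, mehlerCoeff x w k * t ^ k := by
  have hpos : 0 < 1 - t ^ 2 := by nlinarith [abs_lt.1 ht]
  have hr : √(1 - t ^ 2) ≠ 0 := (Real.sqrt_pos.2 hpos).ne'
  have h := tsum_mehlerCoeff x w ht
  have hexp : exp (-x ^ 2 / 2) = exp (-((x - t * w) / √(1 - t ^ 2)) ^ 2 / 2) *
      exp ((t ^ 2 * (x ^ 2 + w ^ 2) - 2 * t * (x * w)) / (2 * (1 - t ^ 2))) := by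
    rw [← Real.exp_add, div_pow, Real.sq_sqrt hpos.le]
    congr 1
    field_simp
    ring
  rw [stdGaussianPDF, stdGaussianPDF, hexp, one_div_mul_eq_div, div_eq_iff hr]
  linear_combination -(1 / √(2 * π) * exp (-((x - t * w) / √(1 - t ^ 2)) ^ 2 / 2)) * h

lemma abs_tsum_mehlerCoeff_sub_le (x w : ℝ) {t : ℝ} (ht : |t| < 1 / 48) (N : ℕ) :
    |∑' k, mehlerCoeff x w k * t ^ k - ∑' k, mehlerCoeff x w k * (-t) ^ k -
      2 * ∑ k ∈ range N, mehlerCoeff x w (2 * k + 1) * t ^ (2 * k + 1)| ≤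
      4 * exp ((x ^ 2 + w ^ 2) / 4) * (24 * |t|) ^ (2 * N + 1) := by
  have hsub := (summable_mehlerCoeff_mul_pow x w ht).hasSum.sub
    (summable_mehlerCoeff_mul_pow x w (t := -t) (by rwa [abs_neg])).hasSum
  have hinj : Function.Injective fun k : ℕ => 2 * k + 1 := fun a b h => by
    simp only at h; omega
  rw [← hinj.hasSum_iff] at hsub
  swap
  · intro k hk
    have hk : Even k := by
      rw [← Nat.not_odd_iff_even]
      rintro ⟨i, rfl⟩
      exact hk ⟨i, rfl⟩
    rw [hk.neg_pow, sub_self]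
  have htail := (hasSum_nat_add_iff' N).2 hsub
  have hfun : ∀ k, ((fun k => mehlerCoeff x w k * t ^ k - mehlerCoeff x w k * (-t) ^ k) ∘
      fun k => 2 * k + 1) k = 2 * (mehlerCoeff x w (2 * k + 1) * t ^ (2 * k + 1)) := by
    intro k
    simp only [Function.comp_apply, (odd_two_mul_add_one k).neg_pow]
    ring
  simp only [hfun, ← Finset.mul_sum] at htail
  have hgeom := (hasSum_geometric_of_lt_one (r := (1 / 2 : ℝ)) (by norm_num)
    (by norm_num)).mul_left (2 * exp ((x ^ 2 + w ^ 2) / 4) * (24 * |t|) ^ (2 * N + 1))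
  refine (htail.norm_le_of_bounded hgeom fun k => ?_).trans_eq (by norm_num; ring)
  rw [Real.norm_eq_abs, abs_mul, abs_mul, abs_pow, abs_two]
  have hsmall : (24 * |t|) ^ 2 ≤ 1 / 2 := by nlinarith [abs_nonneg t]
  calc 2 * (|mehlerCoeff x w (2 * (k + N) + 1)| * |t| ^ (2 * (k + N) + 1))
      ≤ 2 * (24 ^ (2 * (k + N) + 1) * exp ((x ^ 2 + w ^ 2) / 4) *
          |t| ^ (2 * (k + N) + 1)) := by
        gcongr; exact abs_mehlerCoeff_le x w _
    _ = 2 * exp ((x ^ 2 + w ^ 2) / 4) * (24 * |t|) ^ (2 * N + 1) * ((24 * |t|) ^ 2) ^ k := by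
        rw [← pow_mul, mul_assoc _ ((24 * |t|) ^ _), ← pow_add, mul_pow]; ring_nf
    _ ≤ _ := by gcongr

lemma stdGaussianPDF_mul_exp_le_one (x : ℝ) : stdGaussianPDF x * exp (x ^ 2 / 4) ≤ 1 := by
  have hs : 1 ≤ √(2 * π) := Real.one_le_sqrt.2 (by nlinarith [Real.pi_gt_three])
  rw [stdGaussianPDF, mul_assoc, ← Real.exp_add]
  refine mul_le_one₀ ((div_le_one (by positivity)).2 hs) (by positivity) (Real.exp_le_one_iff.2 ?_)
  nlinarith [sq_nonneg x]

lemma abs_pdfExpErr_le (κ : ℝ) (J n : ℕ) (y z : ℝ) {q : ℝ} (hq : 48 < q)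
    (hr : rseq κ n = q ^ 4) :
    |pdfExpErr κ J n y z| ≤
      4 * 24 ^ (2 * J + 3) * exp ((y / q) ^ 2 / 4) / q ^ (2 * J + 3) := by
  have hq0 : 0 < q := by linarith
  have hsqrt : √(q ^ 4) = q ^ 2 := by
    rw [show q ^ 4 = (q ^ 2) ^ 2 by ring, Real.sqrt_sq (by positivity)]
  have hroot : (q ^ 4) ^ ((1 : ℝ) / 4) = q := by
    rw [one_div]; exact_mod_cast Real.pow_rpow_inv_natCast hq0.le (n := 4) (by norm_num)
  have hpow : ∀ k : ℕ, (q ^ 4) ^ (-(2 * (k : ℝ) + 1) / 4) = q⁻¹ ^ (2 * k + 1) := by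
    intro k
    rw [show -(2 * (k : ℝ) + 1) / 4 = (1 : ℝ) / 4 * -((2 * k + 1 : ℕ) : ℝ) by push_cast; ring,
      Real.rpow_mul (by positivity), hroot, Real.rpow_neg hq0.le, Real.rpow_natCast, inv_pow]
  have ht : |q⁻¹| < 1 / 48 := by
    rw [abs_of_pos (by positivity), one_div]
    exact inv_strictAnti₀ (by norm_num) hq
  have hpos : 0 < 1 - q⁻¹ ^ 2 := by nlinarith [abs_lt.1 ht]
  have hs0 : √(1 - q⁻¹ ^ 2) ≠ 0 := (Real.sqrt_pos.2 hpos).ne'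
  have hsub : √(q ^ 4 - q ^ 2) = q ^ 2 * √(1 - q⁻¹ ^ 2) := by
    rw [show q ^ 4 - q ^ 2 = (q ^ 2) ^ 2 * (1 - q⁻¹ ^ 2) by field_simp,
      Real.sqrt_mul (by positivity), Real.sqrt_sq (by positivity)]
  have hM := stdGaussianPDF_div_eq_tsum (z / q ^ 2) (y / q) ht
  have hM' := stdGaussianPDF_div_eq_tsum (z / q ^ 2) (y / q) (t := -q⁻¹) (by rwa [abs_neg])
  rw [neg_sq] at hM'
  have hB := abs_tsum_mehlerCoeff_sub_le (z / q ^ 2) (y / q) ht (J + 1)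
  have herr : pdfExpErr κ J n y z = stdGaussianPDF (z / q ^ 2) *
      (∑' k, mehlerCoeff (z / q ^ 2) (y / q) k * q⁻¹ ^ k -
        ∑' k, mehlerCoeff (z / q ^ 2) (y / q) k * (-q⁻¹) ^ k -
      2 * ∑ k ∈ range (J + 1),
        mehlerCoeff (z / q ^ 2) (y / q) (2 * k + 1) * q⁻¹ ^ (2 * k + 1)) := by
    rw [mul_sub, mul_sub, ← hM, ← hM', pdfExpErr, hr, hsqrt, hsub, hroot, ← mul_sub]
    congr 1
    · congr 1
      · field_simp
      · congr 2
        · field_simp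
        · field_simp
          ring
    · rw [← mul_assoc, mul_comm 2]
      congr 1
      refine Finset.sum_congr rfl fun k _ => ?_
      rw [hpow, mehlerCoeff]
      ring
  have hφ : 0 ≤ stdGaussianPDF (z / q ^ 2) := by rw [stdGaussianPDF]; positivity
  rw [herr, abs_mul, abs_of_nonneg hφ]
  calc _ ≤ stdGaussianPDF (z / q ^ 2) * (4 * exp (((z / q ^ 2) ^ 2 + (y / q) ^ 2) / 4) *
        (24 * |q⁻¹|) ^ (2 * (J + 1) + 1)) := by gcongr
    _ = stdGaussianPDF (z / q ^ 2) * exp ((z / q ^ 2) ^ 2 / 4) *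
        (4 * 24 ^ (2 * J + 3) * exp ((y / q) ^ 2 / 4) / q ^ (2 * J + 3)) := by
        rw [abs_of_pos (by positivity : 0 < q⁻¹), add_div, Real.exp_add, mul_pow, inv_pow]
        ring
    _ ≤ _ := mul_le_of_le_one_left (by positivity) (stdGaussianPDF_mul_exp_le_one _)

/-- Lemma 2.8: for `κ > 1`, `m ∈ ℕ`, `K > 0` and an integer `J > 2m + (Kκ + 1)/2`,
the error in the truncated Hermite expansion of the Gaussian density difference satisfies
`r_n^{m+1} · sup { |ε_n(y,z)| : z ∈ ℝ, |y| ≤ √(K √r_n log n) } → 0` as `n → ∞`. -/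
theorem pdfExpErr_tendsto_zero (κ : ℝ) (hκ : 1 < κ) (m : ℕ) (K : ℝ) (hK : 0 < K)
    (J : ℕ) (hJ : 2 * (m : ℝ) + (K * κ + 1) / 2 < (J : ℝ)) :
    ∀ δ > 0, ∀ᶠ n : ℕ in atTop, ∀ z y : ℝ,
      |y| ≤ Real.sqrt (K * Real.sqrt (rseq κ n) * Real.log n) →
      (rseq κ n) ^ (m + 1) * |pdfExpErr κ J n y z| < δ := by
  intro δ hδ
  have hκ0 : 0 < κ := by linarith
  have hlim : Tendsto (fun n : ℕ => 4 * 24 ^ (2 * J + 3) *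
      (n : ℝ) ^ (-((2 * J - 4 * m - 1 - K * κ) / (4 * κ)))) atTop (nhds (4 * 24 ^ (2 * J + 3) * 0)) :=
    ((tendsto_rpow_neg_atTop (div_pos (by linarith) (by positivity))).comp
      tendsto_natCast_atTop_atTop).const_mul _
  rw [mul_zero] at hlim
  have hqlim : Tendsto (fun n : ℕ => (n : ℝ) ^ (1 / (4 * κ))) atTop atTop :=
    (tendsto_rpow_atTop (by positivity)).comp tendsto_natCast_atTop_atTop
  filter_upwards [hlim.eventually_lt_const hδ, hqlim.eventually_gt_atTop 48, eventually_gt_atTop 0]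
    with n hn hq hn0 z y hy
  have hnpos : (0 : ℝ) < n := by exact_mod_cast hn0
  have hlog : 0 ≤ Real.log n := Real.log_natCast_nonneg n
  have hqpow : ∀ k : ℕ, ((n : ℝ) ^ (1 / (4 * κ))) ^ k = (n : ℝ) ^ (k / (4 * κ)) := by
    intro k
    rw [← Real.rpow_mul_natCast hnpos.le, one_div_mul_eq_div]
  have hr : rseq κ n = ((n : ℝ) ^ (1 / (4 * κ))) ^ 4 := by
    rw [hqpow, rseq]
    congr 1
    push_cast
    field_simp
  have hb := abs_pdfExpErr_le κ J n y z hq hr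
  have hq0 : 0 < (n : ℝ) ^ (1 / (4 * κ)) := by positivity
  have hexp : exp ((y / (n : ℝ) ^ (1 / (4 * κ))) ^ 2 / 4) ≤ (n : ℝ) ^ (K / 4) := by
    rw [Real.rpow_def_of_pos hnpos (K / 4)]
    refine Real.exp_le_exp.2 ?_
    have hy2 := pow_le_pow_left₀ (abs_nonneg y) hy 2
    rw [sq_abs, Real.sq_sqrt (by positivity), hr,
      show ∀ q : ℝ, q ^ 4 = (q ^ 2) ^ 2 by intro q; ring, Real.sqrt_sq (by positivity)] at hy2
    have : (y / (n : ℝ) ^ (1 / (4 * κ))) ^ 2 ≤ K * Real.log n := by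
      rw [div_pow, div_le_iff₀ (by positivity)]
      linarith
    linarith
  calc rseq κ n ^ (m + 1) * |pdfExpErr κ J n y z|
      ≤ (((n : ℝ) ^ (1 / (4 * κ))) ^ 4) ^ (m + 1) * (4 * 24 ^ (2 * J + 3) * (n : ℝ) ^ (K / 4) /
        ((n : ℝ) ^ (1 / (4 * κ))) ^ (2 * J + 3)) := by
        rw [hr]
        gcongr
        exact hb.trans (by gcongr)
    _ = 4 * 24 ^ (2 * J + 3) * ((n : ℝ) ^ (((4 * (m + 1) : ℕ) : ℝ) / (4 * κ)) * (n : ℝ) ^ (K / 4) /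
        (n : ℝ) ^ (((2 * J + 3 : ℕ) : ℝ) / (4 * κ))) := by
        rw [← pow_mul, hqpow, hqpow]; ring
    _ = 4 * 24 ^ (2 * J + 3) * (n : ℝ) ^ (-((2 * J - 4 * m - 1 - K * κ) / (4 * κ))) := by
        rw [← Real.rpow_add hnpos, ← Real.rpow_sub hnpos]
        congr 2
        push_cast
        field_simp
        ring
    _ < δ := hn
end
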